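/- Let Φ be a WCTL formula and A a one-clock priced timed automaton. Then there exists a finite set of constants {a_0,…,a_n} with 0 = a_0 < a_1 < … < a_n < a_{n+1} = +∞ such that: (i) for every location q of A and every 0 ≤ i ≤ n, the truth value of Φ is the same at all states (q,x) with a_i < x < a_{i+1}; (ii) {a_0,…,a_n} contains every constant appearing in the clock constraints of A; (iii) every a_i (i ≤ n) is an integral multiple of 1/C^{h(Φ)}, where h(Φ) is the constrained temporal height of Φ and C is the lcm of all positive cost rates labeling locations of A; (iv) a_n equals the largest constant M appearing in the guards of A. In particular n ≤ M·C^{h(Φ)} + 1. -/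

import Mathlib

/-! ## One-clock priced timed automata: common definitions -/

/-- Comparison operators used in clock constraints and cost constraints. -/
inductive Cmp
  | lt | le | eq | ge | gt
  deriving DecidableEq

/-- Satisfaction of `x ∼ c`. -/
def Cmp.sat : Cmp → ℝ → ℝ → Prop
  | .lt, x, c => x < c
  | .le, x, c => x ≤ c
  | .eq, x, c => x = c
  | .ge, x, c => c ≤ x
  | .gt, x, c => c < x

/-- A guard (clock constraint) is a finite conjunction of constraints `x ∼ c`, `c ∈ ℕ`. -/
abbrev PGuard := List (Cmp × ℕ)

/-- A clock value satisfies a guard if it satisfies all its atomic constraints. -/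
def PGuard.sat (g : PGuard) (x : ℝ) : Prop := ∀ p ∈ g, Cmp.sat p.1 x (p.2 : ℝ)

/-- A transition of a one-clock priced timed automaton: source, guard, reset set
(`reset = true` iff the clock is reset), target, and discrete cost. -/
structure PTrans (Q : Type) where
  src : Q
  guard : PGuard
  reset : Bool
  tgt : Q
  dcost : ℕ

/-- A one-clock priced timed automaton with a single cost function:
a finite set `Q` of locations, an initial location, a finite set of transitions,
invariants, and a cost rate for each location (discrete costs are on transitions). -/
structure PTA (Q : Type) [Fintype Q] where
  init : Q
  E : Set (PTrans Q)
  finE : E.Finite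
  Inv : Q → PGuard
  rate : Q → ℕ

variable {Q : Type} [Fintype Q]

/-- A delay move `(q,v) → (q,v+t)` of cost `t · rate q`, allowed if the invariant
holds throughout. -/
def DelayMove (A : PTA Q) (s : Q × ℝ) (c : ℝ) (s' : Q × ℝ) : Prop :=
  ∃ t : ℝ, 0 ≤ t ∧ s' = (s.1, s.2 + t) ∧ c = t * (A.rate s.1 : ℝ) ∧
    ∀ t' : ℝ, 0 ≤ t' → t' ≤ t → PGuard.sat (A.Inv s.1) (s.2 + t')

/-- A discrete move via a transition of `A`, of cost the discrete cost of the transition. -/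
def DiscMove (A : PTA Q) (s : Q × ℝ) (c : ℝ) (s' : Q × ℝ) : Prop :=
  ∃ e ∈ A.E, e.src = s.1 ∧ e.tgt = s'.1 ∧ PGuard.sat e.guard s.2 ∧
    s'.2 = (if e.reset then 0 else s.2) ∧ PGuard.sat (A.Inv e.tgt) s'.2 ∧ c = (e.dcost : ℝ)

/-- A simple move of the timed transition system `TTS_A`. -/
def PMove (A : PTA Q) (s : Q × ℝ) (c : ℝ) (s' : Q × ℝ) : Prop :=
  DelayMove A s c s' ∨ DiscMove A s c s'

/-- `PPath A s c s'`: there is a path (finite sequence of simple moves) in `TTS_A`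
from `s` to `s'` of total cost `c`. -/
inductive PPath (A : PTA Q) : (Q × ℝ) → ℝ → (Q × ℝ) → Prop
  | refl (s : Q × ℝ) : PPath A s 0 s
  | step {s s' s'' : Q × ℝ} {c c' : ℝ} :
      PMove A s c s' → PPath A s' c' s'' → PPath A s (c + c') s''

/-- Reachability in `TTS_A` (notation `⇝*` in the paper). -/
def PReach (A : PTA Q) (s s' : Q × ℝ) : Prop := ∃ c : ℝ, PPath A s c s'

/-- A mixed move: a delay move followed by a discrete move. -/
def MixedMove (A : PTA Q) (s : Q × ℝ) (c : ℝ) (s' : Q × ℝ) : Prop :=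
  ∃ (c₁ c₂ : ℝ) (m : Q × ℝ), DelayMove A s c₁ m ∧ DiscMove A m c₂ s' ∧ c = c₁ + c₂

/-- A priced timed automaton is non-blocking. -/
def NonBlocking (A : PTA Q) : Prop :=
  ∀ (q : Q) (v : ℝ), 0 ≤ v → ∃ (c : ℝ) (s' : Q × ℝ), MixedMove A (q, v) c s'

/-- The constants appearing in the clock constraints (guards and invariants) of `A`. -/
def PTA.consts (A : PTA Q) : Set ℕ :=
  {c | (∃ e ∈ A.E, ∃ p ∈ e.guard, p.2 = c) ∨ ∃ q : Q, ∃ p ∈ A.Inv q, p.2 = c}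

/-- The lcm of all positive cost rates labeling a location of `A`. -/
def posLcm (A : PTA Q) : ℕ :=
  Finset.lcm (Finset.univ.filter fun q => 0 < A.rate q) A.rate

/-! ## WCTL: syntax and semantics -/

/-- Syntax of WCTL over atomic propositions `AP` (with a trivially true formula `tt`). -/
inductive WCTL (AP : Type)
  | tt : WCTL AP
  | atom : AP → WCTL AP
  | not : WCTL AP → WCTL AP
  | or : WCTL AP → WCTL AP → WCTL AP
  | EU : WCTL AP → Cmp → ℕ → WCTL AP → WCTL AP
  | AU : WCTL AP → Cmp → ℕ → WCTL AP → WCTL AP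

/-- An infinite run of `A` from `s₀`: an infinite sequence of mixed moves,
`cst n` being the cost of the `n`-th mixed move. -/
structure InfRun (A : PTA Q) (s₀ : Q × ℝ) where
  st : ℕ → Q × ℝ
  cst : ℕ → ℝ
  first : st 0 = s₀
  step : ∀ n : ℕ, MixedMove A (st n) (cst n) (st (n + 1))

/-- Satisfaction of WCTL formulas over states of a labeled one-clock priced timed
automaton (`L` is the labeling function). -/
def WCTLsat {AP : Type} (A : PTA Q) (L : Q → AP → Prop) : WCTL AP → (Q × ℝ) → Prop
  | .tt, _ => True
  | .atom a, s => L s.1 a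
  | .not φ, s => ¬ WCTLsat A L φ s
  | .or φ ψ, s => WCTLsat A L φ s ∨ WCTLsat A L ψ s
  | .EU φ cmp c ψ, s => ∃ ρ : InfRun A s, ∃ π : ℕ, 0 < π ∧ WCTLsat A L ψ (ρ.st π) ∧
      (∀ π' : ℕ, 0 < π' → π' < π → WCTLsat A L φ (ρ.st π')) ∧
      Cmp.sat cmp (∑ i ∈ Finset.range π, ρ.cst i) (c : ℝ)
  | .AU φ cmp c ψ, s => ∀ ρ : InfRun A s, ∃ π : ℕ, 0 < π ∧ WCTLsat A L ψ (ρ.st π) ∧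
      (∀ π' : ℕ, 0 < π' → π' < π → WCTLsat A L φ (ρ.st π')) ∧
      Cmp.sat cmp (∑ i ∈ Finset.range π, ρ.cst i) (c : ℝ)

/-- A cost constraint `∼ c` is trivial iff it is `≥ 0`. -/
def isTrivialC : Cmp → ℕ → Bool
  | .ge, 0 => true
  | _, _ => false

/-- The constrained temporal height of a WCTL formula: the maximal number of nested
constrained modalities (modalities whose constraint is not equivalent to `≥ 0`). -/
def cheight {AP : Type} : WCTL AP → ℕ
  | .tt => 0
  | .atom _ => 0
  | .not φ => cheight φ
  | .or φ ψ => max (cheight φ) (cheight ψ)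
  | .EU φ cmp c ψ => max (cheight φ) (cheight ψ) + (if isTrivialC cmp c then 0 else 1)
  | .AU φ cmp c ψ => max (cheight φ) (cheight ψ) + (if isTrivialC cmp c then 0 else 1)

/-! ## Rounding of clock trajectories -/

namespace ClockTrace

/-- Clock value at the beginning of the `n`-th step of a trajectory which starts at `z`, lets the
clock grow to `w i` during the `i`-th step, and resets it at the end of step `i` iff `R i`. -/
def entry (R : ℕ → Bool) (z : ℝ) (w : ℕ → ℝ) : ℕ → ℝ
  | 0 => z
  | n + 1 => if R n then 0 else w n

/-- What is left of an initial budget `u` after `n` steps, when step `j` has rate `r j` and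
discrete cost `d j`. -/
noncomputable def budget (r d : ℕ → ℕ) (R : ℕ → Bool) (z u : ℝ) (w : ℕ → ℝ) (n : ℕ) : ℝ :=
  u - ∑ j ∈ Finset.range n, ((r j : ℝ) * (w j - entry R z w j) + d j)

/-- `b` satisfies every weak sign condition satisfied by `a`. -/
def WeakSign (a b : ℝ) : Prop := (0 ≤ a → 0 ≤ b) ∧ (a ≤ 0 → b ≤ 0)

/-- `z` lies in the closure of the integer cell (integer point or open unit interval) of `x`. -/
def InCell (x z : ℝ) : Prop := (⌊x⌋ : ℝ) ≤ z ∧ z ≤ ⌈x⌉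

/-- The trajectory `(z, w)` with budget `v` follows `(x, m)` with budget `u` for `n` steps, up to
taking closures of cells and of sign conditions. -/
def Follows (r d : ℕ → ℕ) (R : ℕ → Bool) (x u : ℝ) (m : ℕ → ℝ) (z v : ℝ) (w : ℕ → ℝ)
    (n : ℕ) : Prop :=
  (∀ i, InCell (m i) (w i)) ∧ (∀ i < n, entry R z w i ≤ w i) ∧
    ∀ i ≤ n, WeakSign (budget r d R x u m i) (budget r d R z v w i)

lemma inCell_self (x : ℝ) : InCell x x := ⟨Int.floor_le x, Int.le_ceil x⟩

lemma inCell_ceil (x : ℝ) : InCell x ⌈x⌉ :=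
  ⟨(Int.floor_le x).trans (Int.le_ceil x), le_rfl⟩

lemma entry_succ_eq (R : ℕ → Bool) (z : ℝ) (w : ℕ → ℝ) (n : ℕ) :
    entry R z w (n + 1) =
      entry (fun i => R (i + 1)) (if R 0 then 0 else w 0) (fun i => w (i + 1)) n := by
  cases n <;> rfl

lemma budget_zero (r d : ℕ → ℕ) (R : ℕ → Bool) (z u : ℝ) (w : ℕ → ℝ) :
    budget r d R z u w 0 = u := by
  simp [budget]

lemma budget_succ_eq (r d : ℕ → ℕ) (R : ℕ → Bool) (z u : ℝ) (w : ℕ → ℝ) (n : ℕ) :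
    budget r d R z u w (n + 1) =
      budget (fun i => r (i + 1)) (fun i => d (i + 1)) (fun i => R (i + 1))
        (if R 0 then 0 else w 0) (u - r 0 * (w 0 - z) - d 0) (fun i => w (i + 1)) n := by
  simp only [budget, Finset.sum_range_succ', entry_succ_eq]
  simp only [entry]
  ring

lemma follows_zero {r d : ℕ → ℕ} {R : ℕ → Bool} {x u : ℝ} {m : ℕ → ℝ} {z v : ℝ}
    (h : WeakSign u v) : Follows r d R x u m z v m 0 := by
  refine ⟨fun i => inCell_self _, by simp, fun i hi => ?_⟩
  obtain rfl : i = 0 := by omega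
  simpa [budget_zero] using h

lemma follows_succ {r d : ℕ → ℕ} {R : ℕ → Bool} {x u : ℝ} {m : ℕ → ℝ} {z v w₀ : ℝ} {w : ℕ → ℝ}
    {n : ℕ} (hs : WeakSign u v) (hz : z ≤ w₀) (hc : InCell (m 0) w₀)
    (h : Follows (fun i => r (i + 1)) (fun i => d (i + 1)) (fun i => R (i + 1))
      (if R 0 then 0 else m 0) (u - r 0 * (m 0 - x) - d 0) (fun i => m (i + 1))
      (if R 0 then 0 else w₀) (v - r 0 * (w₀ - z) - d 0) w n) :
    ∃ w', Follows r d R x u m z v w' (n + 1) := by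
  refine ⟨fun i => Nat.casesOn i w₀ w, ?_, ?_, ?_⟩
  · rintro (_ | i)
    · exact hc
    · exact h.1 i
  · rintro (_ | i) hi
    · exact hz
    · rw [entry_succ_eq]
      exact h.2.1 i (by omega)
  · rintro (_ | i) hi
    · simpa [budget_zero] using hs
    · rw [budget_succ_eq, budget_succ_eq]
      exact h.2.2 i (by omega)

lemma valid_tail {R : ℕ → Bool} {x : ℝ} {m : ℕ → ℝ} (hm : ∀ i, entry R x m i ≤ m i) (i : ℕ) :
    entry (fun i => R (i + 1)) (if R 0 then 0 else m 0) (fun i => m (i + 1)) i ≤ m (i + 1) := by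
  rw [← entry_succ_eq]
  exact hm (i + 1)

lemma inCell_next {R : ℕ → Bool} {m : ℕ → ℝ} {w₀ : ℝ} (h : InCell (m 0) w₀) :
    InCell (if R 0 then 0 else m 0) (if R 0 then 0 else w₀) := by
  split_ifs
  · exact inCell_self 0
  · exact h

lemma floor_ceil_of_le {x m : ℝ} (h : x ≤ m) :
    (⌊m⌋ = ⌊x⌋ ∧ ⌈m⌉ = ⌈x⌉) ∨ ⌈x⌉ ≤ ⌊m⌋ := by
  by_cases hc : ⌈x⌉ ≤ ⌊m⌋
  · exact Or.inr hc
  · left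
    push Not at hc
    have h1 := Int.floor_le_floor h
    have h2 := Int.ceil_le_floor_add_one x
    have h3 := Int.ceil_le_floor_add_one m
    have h4 := Int.ceil_le_ceil h
    omega

lemma exists_follows_of_nonpos (n : ℕ) : ∀ {r d : ℕ → ℕ} {R : ℕ → Bool} {x u : ℝ} {m : ℕ → ℝ},
    (∀ i, entry R x m i ≤ m i) → u ≤ 0 → ∀ {z v : ℝ}, InCell x z → v ≤ 0 → (u = 0 → v = 0) →
    ∃ w, Follows r d R x u m z v w n := by
  induction n with
  | zero =>
    intro r d R x u m _ hu z v _ hv huv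
    exact ⟨m, follows_zero ⟨fun h => (huv (le_antisymm hu h)).ge, fun _ => hv⟩⟩
  | succ n ih =>
    intro r d R x u m hm hu z v hz hv huv
    have hxm : x ≤ m 0 := hm 0
    have hs : WeakSign u v := ⟨fun h => (huv (le_antisymm hu h)).ge, fun _ => hv⟩
    have hd : (0 : ℝ) ≤ d 0 := Nat.cast_nonneg _
    have hr : (0 : ℝ) ≤ r 0 := Nat.cast_nonneg _
    have hrm : 0 ≤ (r 0 : ℝ) * (m 0 - x) := mul_nonneg hr (by linarith)
    have hceil : z ≤ ⌈m 0⌉ := hz.2.trans (by exact_mod_cast Int.ceil_le_ceil hxm)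
    have key : ∃ w₀, z ≤ w₀ ∧ InCell (m 0) w₀ ∧
        (u - r 0 * (m 0 - x) - d 0 = 0 → v - r 0 * (w₀ - z) - d 0 = 0) := by
      by_cases hmx : m 0 = x
      · refine ⟨z, le_rfl, hmx ▸ hz, fun h => ?_⟩
        have := huv (by linarith)
        rw [hmx] at h
        have : u = 0 := by linarith
        linarith
      · refine ⟨⌈m 0⌉, hceil, inCell_ceil _, fun h => ?_⟩
        have h0 : (r 0 : ℝ) * (m 0 - x) = 0 := by linarith
        have hr0 : (r 0 : ℝ) = 0 := by
          rcases mul_eq_zero.1 h0 with h' | h'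
          · exact h'
          · exact absurd (by linarith) hmx
        have := huv (by linarith)
        rw [hr0] at h ⊢
        linarith
    obtain ⟨w₀, h1, h2, h3⟩ := key
    have hrw : 0 ≤ (r 0 : ℝ) * (w₀ - z) := mul_nonneg hr (by linarith)
    obtain ⟨w, hw⟩ := ih (valid_tail hm) (by linarith) (inCell_next (R := R) h2) (by linarith) h3
    exact follows_succ hs h1 h2 hw

/-- A budget between the two affine bounds can be met by a suitable delay. -/
lemma exists_delay {l k p s r c b u : ℝ} (hcb : c ≤ b) (hb1 : b ≤ c + 1)
    (hlk : l ≤ k) (hlk' : l + s ≤ k + p)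
    (hl : l + min s r * (b - c) ≤ u) (hk : u ≤ k + max p r * (b - c)) :
    ∃ w, c ≤ w ∧ w ≤ b ∧ l + s * (b - w) ≤ u - r * (w - c) ∧
      u - r * (w - c) ≤ k + p * (b - w) := by
  have hAB : ∀ w, c ≤ w → w ≤ b →
      l + s * (b - w) + r * (w - c) ≤ k + p * (b - w) + r * (w - c) := by
    intro w h1 h2
    nlinarith [mul_nonneg (sub_nonneg.2 hlk) (sub_nonneg.2 (show b - w ≤ 1 by linarith)),
      mul_nonneg (sub_nonneg.2 hlk') (sub_nonneg.2 h2)]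
  rcases lt_or_ge u (l + s * (b - c)) with h | h
  · have hr : l + r * (b - c) ≤ u := by
      rcases min_choice s r with h' | h' <;> rw [h'] at hl <;> linarith
    obtain ⟨w, hw, hwu⟩ : u ∈ (fun w => l + s * (b - w) + r * (w - c)) '' Set.Icc c b := by
      apply intermediate_value_Icc' hcb (by fun_prop)
      constructor <;> simp <;> linarith
    have := hAB w hw.1 hw.2
    simp only at hwu
    exact ⟨w, hw.1, hw.2, by linarith, by linarith⟩
  rcases lt_or_ge (k + p * (b - c)) u with h' | h'
  · have hr : u ≤ k + r * (b - c) := by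
      rcases max_choice p r with h' | h' <;> rw [h'] at hk <;> linarith
    obtain ⟨w, hw, hwu⟩ : u ∈ (fun w => k + p * (b - w) + r * (w - c)) '' Set.Icc c b := by
      apply intermediate_value_Icc hcb (by fun_prop)
      constructor <;> simp <;> linarith
    have := hAB w hw.1 hw.2
    simp only at hwu
    exact ⟨w, hw.1, hw.2, by linarith, by linarith⟩
  · exact ⟨c, le_rfl, hcb, by linarith, by linarith⟩

/-- On the cell of `x`, all budgets between two affine functions with integral values at the right
end and with slopes in `P` can be used to follow `(x, m)`, and `u` lies between them. -/
def HasBox (P : ℕ → Prop) (r d : ℕ → ℕ) (R : ℕ → Bool) (x u : ℝ) (m : ℕ → ℝ) (n : ℕ) : Prop :=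
  ∃ (l k : ℤ) (s p : ℕ), P s ∧ P p ∧ 0 ≤ l ∧ l ≤ k ∧ l + s ≤ k + p ∧
    l + s * (⌈x⌉ - x) ≤ u ∧ u ≤ k + p * (⌈x⌉ - x) ∧
    ∀ z v : ℝ, InCell x z → l + s * (⌈x⌉ - z) ≤ v → v ≤ k + p * (⌈x⌉ - z) →
      ∃ w, Follows r d R x u m z v w n

lemma HasBox.succ {P : ℕ → Prop} {r d : ℕ → ℕ} {R : ℕ → Bool} {x u : ℝ} {m : ℕ → ℝ} {n : ℕ}
    (hP0 : P 0) (hPr : ∀ i, P (r i)) (hxm : x ≤ m 0) (hu : 0 < u)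
    (h : HasBox P (fun i => r (i + 1)) (fun i => d (i + 1)) (fun i => R (i + 1))
      (if R 0 then 0 else m 0) (u - r 0 * (m 0 - x) - d 0) (fun i => m (i + 1)) n) :
    HasBox P r d R x u m (n + 1) := by
  have hd : (0 : ℝ) ≤ d 0 := Nat.cast_nonneg _
  have hr : (0 : ℝ) ≤ r 0 := Nat.cast_nonneg _
  -- the box just before the discrete move
  obtain ⟨l, k, s, p, hs, hp, hl, hlk, hlk', hlu, huk, H⟩ :
      ∃ (l k : ℤ) (s p : ℕ), P s ∧ P p ∧ 0 ≤ l ∧ l ≤ k ∧ l + s ≤ k + p ∧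
        l + s * (⌈m 0⌉ - m 0) ≤ u - r 0 * (m 0 - x) ∧
        u - r 0 * (m 0 - x) ≤ k + p * (⌈m 0⌉ - m 0) ∧
        ∀ z v w₀ : ℝ, WeakSign u v → z ≤ w₀ → InCell (m 0) w₀ →
          l + s * (⌈m 0⌉ - w₀) ≤ v - r 0 * (w₀ - z) →
          v - r 0 * (w₀ - z) ≤ k + p * (⌈m 0⌉ - w₀) →
          ∃ w, Follows r d R x u m z v w (n + 1) := by
    obtain ⟨l, k, s, p, hs, hp, hl, hlk, hlk', hlu, huk, H⟩ := h
    rcases hR : R 0 with _ | _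
    · simp only [hR, Bool.false_eq_true, if_false] at hlu huk H
      refine ⟨l + d 0, k + d 0, s, p, hs, hp, by omega, by omega, by omega, ?_, ?_, ?_⟩
      · push_cast; linarith
      · push_cast; linarith
      · intro z v w₀ h1 h2 h3 h4 h5
        push_cast at h4 h5
        obtain ⟨w, hw⟩ := H w₀ (v - r 0 * (w₀ - z) - d 0) h3 (by linarith) (by linarith)
        exact follows_succ h1 h2 h3 (by simpa [hR] using hw)
    · simp only [hR, if_true, Int.ceil_zero, Int.cast_zero, sub_zero, mul_zero, add_zero]
        at hlu huk H
      refine ⟨l + d 0, k + d 0, 0, 0, hP0, hP0, by omega, by omega, by omega, ?_, ?_, ?_⟩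
      · push_cast; linarith
      · push_cast; linarith
      · intro z v w₀ h1 h2 h3 h4 h5
        push_cast at h4 h5
        obtain ⟨w, hw⟩ := H 0 (v - r 0 * (w₀ - z) - d 0) (inCell_self 0) (by linarith)
          (by linarith)
        exact follows_succ h1 h2 h3 (by simpa [hR] using hw)
  have hmin : P (min s (r 0)) := by
    rcases min_choice s (r 0) with h | h <;> rw [h] <;> simp [hs, hPr]
  have hmax : P (max p (r 0)) := by
    rcases max_choice p (r 0) with h | h <;> rw [h] <;> simp [hp, hPr]
  have hmr : ((min s (r 0) : ℕ) : ℝ) ≤ r 0 := by exact_mod_cast min_le_right _ _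
  have hms : ((min s (r 0) : ℕ) : ℝ) ≤ s := by exact_mod_cast min_le_left _ _
  have hMr : (r 0 : ℝ) ≤ (max p (r 0) : ℕ) := by exact_mod_cast le_max_right _ _
  have hMp : (p : ℝ) ≤ (max p (r 0) : ℕ) := by exact_mod_cast le_max_left _ _
  have hm0 : (0 : ℝ) ≤ (min s (r 0) : ℕ) := Nat.cast_nonneg _
  have hlR : (0 : ℝ) ≤ l := by exact_mod_cast hl
  have hlkR : (l : ℝ) ≤ k := by exact_mod_cast hlk
  have hlkR' : (l : ℝ) + s ≤ k + p := by exact_mod_cast hlk'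
  have hc1 : (⌈m 0⌉ : ℝ) ≤ ⌊m 0⌋ + 1 := by exact_mod_cast Int.ceil_le_floor_add_one (m 0)
  have hfm := Int.floor_le (m 0)
  have hcm := Int.le_ceil (m 0)
  rcases floor_ceil_of_le hxm with ⟨hf, hc⟩ | hfc
  · have hfR : (⌊m 0⌋ : ℝ) = ⌊x⌋ := by exact_mod_cast hf
    have hcR : (⌈m 0⌉ : ℝ) = ⌈x⌉ := by exact_mod_cast hc
    refine ⟨l, k, min s (r 0), max p (r 0), hmin, hmax, hl, hlk, ?_, ?_, ?_, ?_⟩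
    · have : min s (r 0) ≤ max p (r 0) := (min_le_right _ _).trans (le_max_right _ _)
      omega
    · rw [← hcR]
      nlinarith [mul_nonneg (sub_nonneg.2 hmr) (sub_nonneg.2 hxm),
        mul_nonneg (sub_nonneg.2 hms) (sub_nonneg.2 hcm)]
    · rw [← hcR]
      nlinarith [mul_nonneg (sub_nonneg.2 hMr) (sub_nonneg.2 hxm),
        mul_nonneg (sub_nonneg.2 hMp) (sub_nonneg.2 hcm)]
    · intro z v hz hv1 hv2
      rw [← hcR] at hv1 hv2
      push_cast at hv1 hv2
      have hz1 : z ≤ ⌈m 0⌉ := hcR ▸ hz.2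
      have hz2 : ⌊m 0⌋ ≤ z := hfR ▸ hz.1
      have hv0 : 0 ≤ v := by
        have : 0 ≤ min (s : ℝ) (r 0) * (⌈m 0⌉ - z) :=
          mul_nonneg (le_min (Nat.cast_nonneg _) hr) (sub_nonneg.2 hz1)
        linarith
      obtain ⟨w₀, h1, h2, h3, h4⟩ := exists_delay hz1 (by linarith) hlkR hlkR' hv1 hv2
      exact H z v w₀ ⟨fun _ => hv0, fun h => by linarith⟩ h1 ⟨by linarith, h2⟩ h3 h4
  · have hfcR : (⌈x⌉ : ℝ) ≤ ⌊m 0⌋ := by exact_mod_cast hfc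
    have hfcm : ⌊m 0⌋ ≤ ⌈m 0⌉ := Int.floor_le_ceil _
    have hr0 : (0 : ℤ) ≤ r 0 := Int.natCast_nonneg _
    have hgap : (0 : ℤ) ≤ r 0 * (⌊m 0⌋ - ⌈x⌉) := mul_nonneg hr0 (by omega)
    have hlen : (min s (r 0) : ℕ) * (⌈m 0⌉ - ⌊m 0⌋) ≤ (max p (r 0) : ℕ) * (⌈m 0⌉ - ⌊m 0⌋) := by
      apply mul_le_mul_of_nonneg_right _ (by omega)
      exact_mod_cast (min_le_right _ _).trans (le_max_right _ _)
    have hlen0 : (0 : ℤ) ≤ (min s (r 0) : ℕ) * (⌈m 0⌉ - ⌊m 0⌋) :=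
      mul_nonneg (Int.natCast_nonneg _) (by omega)
    refine ⟨r 0 * (⌊m 0⌋ - ⌈x⌉) + l + (min s (r 0) : ℕ) * (⌈m 0⌉ - ⌊m 0⌋),
      r 0 * (⌊m 0⌋ - ⌈x⌉) + k + (max p (r 0) : ℕ) * (⌈m 0⌉ - ⌊m 0⌋), r 0, r 0, hPr 0, hPr 0,
      by linarith, by linarith, by linarith, ?_, ?_, ?_⟩
    · push_cast [-Nat.cast_min]
      nlinarith [mul_nonneg (sub_nonneg.2 hmr) (sub_nonneg.2 hfm),
        mul_nonneg (sub_nonneg.2 hms) (sub_nonneg.2 hcm)]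
    · push_cast [-Nat.cast_max]
      nlinarith [mul_nonneg (sub_nonneg.2 hMr) (sub_nonneg.2 hfm),
        mul_nonneg (sub_nonneg.2 hMp) (sub_nonneg.2 hcm)]
    · intro z v hz hv1 hv2
      push_cast at hv1 hv2
      have hv0 : 0 ≤ v := by
        have h1 : 0 ≤ min (s : ℝ) (r 0) * (⌈m 0⌉ - ⌊m 0⌋) :=
          mul_nonneg (le_min (Nat.cast_nonneg _) hr) (by linarith)
        have h2 : 0 ≤ (r 0 : ℝ) * (⌈x⌉ - z) := mul_nonneg hr (sub_nonneg.2 hz.2)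
        have h3 : 0 ≤ (r 0 : ℝ) * (⌊m 0⌋ - ⌈x⌉) := mul_nonneg hr (by linarith)
        linarith
      obtain ⟨w₀, h1, h2, h3, h4⟩ := exists_delay (c := ⌊m 0⌋) (b := ⌈m 0⌉) (r := r 0)
        (u := v - r 0 * (⌊m 0⌋ - z)) (by linarith) (by linarith) hlkR hlkR'
        (by linarith) (by linarith)
      exact H z v w₀ ⟨fun _ => hv0, fun h => by linarith⟩ (by linarith [hz.2]) ⟨h1, h2⟩
        (by linarith) (by linarith)

lemma hasBox_zero {P : ℕ → Prop} {r d : ℕ → ℕ} {R : ℕ → Bool} {x : ℝ} {m : ℕ → ℝ} {n : ℕ}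
    (hP0 : P 0) (hm : ∀ i, entry R x m i ≤ m i) : HasBox P r d R x 0 m n := by
  refine ⟨0, 0, 0, 0, hP0, hP0, le_rfl, le_rfl, le_rfl, by simp, by simp, fun z v hz h1 h2 => ?_⟩
  obtain rfl : v = 0 := le_antisymm (by simpa using h2) (by simpa using h1)
  exact exists_follows_of_nonpos _ hm le_rfl hz le_rfl fun _ => rfl

lemma hasBox_of_nonneg {P : ℕ → Prop} (hP0 : P 0) (n : ℕ) :
    ∀ {r d : ℕ → ℕ} {R : ℕ → Bool} {x u : ℝ} {m : ℕ → ℝ}, (∀ i, P (r i)) →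
    (∀ i, entry R x m i ≤ m i) → 0 ≤ u → HasBox P r d R x u m n := by
  induction n with
  | zero =>
    intro r d R x u m _ hm hu
    rcases hu.eq_or_lt with rfl | hu
    · exact hasBox_zero hP0 hm
    · refine ⟨0, ⌈u⌉, 0, 0, hP0, hP0, le_rfl, Int.ceil_nonneg hu.le, ?_, by simpa using hu.le,
        by simpa using Int.le_ceil u,
        fun z v hz h1 h2 => ⟨m, follows_zero ⟨fun _ => ?_, fun h => ?_⟩⟩⟩
      · simpa using Int.ceil_nonneg hu.le
      · simpa using h1
      · linarith
  | succ n ih =>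
    intro r d R x u m hPr hm hu
    rcases hu.eq_or_lt with rfl | hu
    · exact hasBox_zero hP0 hm
    have hxm : x ≤ m 0 := hm 0
    rcases le_or_gt 0 (u - r 0 * (m 0 - x) - d 0) with h1 | h1
    · exact HasBox.succ hP0 hPr hxm hu (ih (fun i => hPr (i + 1)) (valid_tail hm) h1)
    have hr : (0 : ℝ) ≤ r 0 := Nat.cast_nonneg _
    have hcc : ⌈x⌉ ≤ ⌈m 0⌉ := Int.ceil_le_ceil hxm
    have hk : (0 : ℤ) ≤ d 0 + r 0 * (⌈m 0⌉ - ⌈x⌉) :=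
      add_nonneg (Int.natCast_nonneg _) (mul_nonneg (Int.natCast_nonneg _) (by omega))
    refine ⟨0, d 0 + r 0 * (⌈m 0⌉ - ⌈x⌉), 0, r 0, hP0, hPr 0, le_rfl, hk, ?_, by simpa using hu.le,
      ?_, fun z v hz hv1 hv2 => ?_⟩
    · push_cast; linarith [Int.natCast_nonneg (r 0)]
    · push_cast
      nlinarith [mul_nonneg hr (sub_nonneg.2 (Int.le_ceil (m 0)))]
    · push_cast at hv2
      obtain ⟨w, hw⟩ := exists_follows_of_nonpos n (r := fun i => r (i + 1))
        (d := fun i => d (i + 1)) (v := v - r 0 * (⌈m 0⌉ - z) - d 0) (valid_tail hm) h1.le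
        (inCell_next (R := R) (inCell_ceil (m 0))) (by linarith) (fun h => absurd h h1.ne)
      refine follows_succ ⟨fun _ => by simpa using hv1, fun h => by linarith⟩ ?_ (inCell_ceil _) hw
      exact hz.2.trans (by exact_mod_cast hcc)

lemma continuous_entry (R : ℕ → Bool) (z : ℝ) (n : ℕ) :
    Continuous fun w : ℕ → ℝ => entry R z w n := by
  cases n with
  | zero => exact continuous_const
  | succ n =>
    simp only [entry]
    split_ifs <;> fun_prop

lemma continuous_budget (r d : ℕ → ℕ) (R : ℕ → Bool) (z u : ℝ) (n : ℕ) :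
    Continuous fun w : ℕ → ℝ => budget r d R z u w n := by
  have := continuous_entry R z
  unfold budget
  fun_prop

lemma isClosed_follows (r d : ℕ → ℕ) (R : ℕ → Bool) (x u : ℝ) (m : ℕ → ℝ) (z v : ℝ) (n : ℕ) :
    IsClosed {w | Follows r d R x u m z v w n} := by
  have he := continuous_entry R z
  have hb := continuous_budget r d R z v
  simp only [Follows, WeakSign, InCell, Set.ofPred_and, Set.ofPred_forall]
  refine .inter (isClosed_iInter fun i => .inter ?_ ?_) (.inter (isClosed_iInter fun i =>
    isClosed_iInter fun _ => ?_) (isClosed_iInter fun i => isClosed_iInter fun _ => .inter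
      (isClosed_iInter fun _ => ?_) (isClosed_iInter fun _ => ?_)))
  · exact isClosed_le continuous_const (continuous_apply i)
  · exact isClosed_le (continuous_apply i) continuous_const
  · exact isClosed_le (he i) (continuous_apply i)
  · exact isClosed_le continuous_const (hb i)
  · exact isClosed_le (hb i) continuous_const

lemma exists_follows_forall {r d : ℕ → ℕ} {R : ℕ → Bool} {x u : ℝ} {m : ℕ → ℝ} {z v : ℝ}
    (h : ∀ n, ∃ w, Follows r d R x u m z v w n) : ∃ w, ∀ n, Follows r d R x u m z v w n := by
  have hsub : ∀ n, {w | Follows r d R x u m z v w n} ⊆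
      Set.univ.pi fun i => Set.Icc (⌊m i⌋ : ℝ) ⌈m i⌉ := fun n w hw i _ => hw.1 i
  obtain ⟨w, hw⟩ := IsCompact.nonempty_iInter_of_sequence_nonempty_isCompact_isClosed
    (fun n => {w | Follows r d R x u m z v w n})
    (fun n w hw => ⟨hw.1, fun i hi => hw.2.1 i (by omega), fun i hi => hw.2.2 i (by omega)⟩)
    h ((isCompact_univ_pi fun i => isCompact_Icc).of_isClosed_subset
      (isClosed_follows r d R x u m z v 0) (hsub 0))
    (isClosed_follows r d R x u m z v)
  exact ⟨w, Set.mem_iInter.1 hw⟩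

lemma inCell_of_mul {K : ℕ} (hK : 0 < K) {x z : ℝ} (h : InCell (K * x) (K * z)) :
    InCell x z := by
  have hK' : (0 : ℝ) < K := by exact_mod_cast hK
  constructor
  · have : (K * ⌊x⌋ : ℤ) ≤ ⌊K * x⌋ := by
      rw [Int.le_floor]; push_cast
      exact mul_le_mul_of_nonneg_left (Int.floor_le x) hK'.le
    have : ((K * ⌊x⌋ : ℤ) : ℝ) ≤ ⌊K * x⌋ := by exact_mod_cast this
    push_cast at this
    exact le_of_mul_le_mul_left (this.trans h.1) hK'
  · have : ⌈K * x⌉ ≤ (K * ⌈x⌉ : ℤ) := by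
      rw [Int.ceil_le]; push_cast
      exact mul_le_mul_of_nonneg_left (Int.le_ceil x) hK'.le
    have : (⌈K * x⌉ : ℝ) ≤ ((K * ⌈x⌉ : ℤ) : ℝ) := by exact_mod_cast this
    push_cast at this
    exact le_of_mul_le_mul_left (h.2.trans this) hK'

/-- Bounds with slope dividing `K` cannot separate points of one closed `1/K`-cell. -/
lemma slope_bounds {K s : ℕ} (hK : 0 < K) (hs : s = 0 ∨ s ∣ K) {x z : ℝ} {b k : ℤ}
    (h : InCell (K * x) (K * z)) :
    (s * (b - x) ≤ (k : ℝ) → s * (b - z) ≤ (k : ℝ)) ∧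
      ((k : ℝ) ≤ s * (b - x) → (k : ℝ) ≤ s * (b - z)) := by
  rcases Nat.eq_zero_or_pos s with rfl | hs0
  · simp
  obtain ⟨t, rfl⟩ : s ∣ K := hs.resolve_left hs0.ne'
  have ht : (0 : ℝ) < t := by exact_mod_cast Nat.pos_of_mul_pos_left hK
  push_cast at h
  constructor <;> intro hk <;> refine le_of_mul_le_mul_left ?_ ht
  · have : (s * t * b - k * t : ℤ) ≤ ⌊(s : ℝ) * t * x⌋ := by
      rw [Int.le_floor]; push_cast
      nlinarith [mul_le_mul_of_nonneg_left hk ht.le]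
    have : ((s * t * b - k * t : ℤ) : ℝ) ≤ ⌊(s : ℝ) * t * x⌋ := by exact_mod_cast this
    push_cast at this
    linarith [h.1]
  · have : ⌈(s : ℝ) * t * x⌉ ≤ (s * t * b - k * t : ℤ) := by
      rw [Int.ceil_le]; push_cast
      nlinarith [mul_le_mul_of_nonneg_left hk ht.le]
    have : (⌈(s : ℝ) * t * x⌉ : ℝ) ≤ ((s * t * b - k * t : ℤ) : ℝ) := by exact_mod_cast this
    push_cast at this
    linarith [h.2]

lemma exists_follows {r d : ℕ → ℕ} {R : ℕ → Bool} {x z : ℝ} {m : ℕ → ℝ} {u K : ℕ} (hK : 0 < K)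
    (hm : ∀ i, entry R x m i ≤ m i) (hu : u = 0 ∨ ∀ i, r i = 0 ∨ r i ∣ K)
    (hz : InCell (K * x) (K * z)) : ∃ w, ∀ n, Follows r d R x u m z u w n := by
  refine exists_follows_forall fun n => ?_
  rcases hu with rfl | hr
  · exact exists_follows_of_nonpos n hm (by simp) (inCell_of_mul hK hz) (by simp) fun h => h
  · obtain ⟨l, k, s, p, hs, hp, -, -, -, h1, h2, H⟩ :=
      hasBox_of_nonneg (P := fun s => s = 0 ∨ s ∣ K) (Or.inl rfl) n (d := d) hr hm
        (Nat.cast_nonneg u)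
    have hl := (slope_bounds hK hs (b := ⌈x⌉) (k := u - l) hz).1 (by push_cast; linarith)
    have hk := (slope_bounds hK hp (b := ⌈x⌉) (k := u - k) hz).2 (by push_cast; linarith)
    push_cast at hl hk
    exact H z u (inCell_of_mul hK hz) (by linarith) (by linarith)

/-- `x` and `y` lie in the same integer cell. -/
def SameCell (x y : ℝ) : Prop := ⌊x⌋ = ⌊y⌋ ∧ ⌈x⌉ = ⌈y⌉

lemma sameCell_combination {x z t : ℝ} (h0 : 0 ≤ t) (h1 : t < 1) (h : InCell x z) :
    SameCell x ((1 - t) * x + t * z) := by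
  have hf := Int.floor_le x
  have hc := Int.le_ceil x
  have h1' := Int.ceil_le_floor_add_one x
  have h1R : (⌈x⌉ : ℝ) ≤ ⌊x⌋ + 1 := by exact_mod_cast h1'
  obtain ⟨hz1, hz2⟩ := h
  have hlow : (⌊x⌋ : ℝ) ≤ (1 - t) * x + t * z := by nlinarith
  have hupp : (1 - t) * x + t * z ≤ ⌈x⌉ := by nlinarith
  rcases hf.eq_or_lt with he | hlt
  · have hx : (⌈x⌉ : ℝ) = x := by rw [← he]; simp
    have : (1 - t) * x + t * z = x := by linarith
    rw [this]
    exact ⟨rfl, rfl⟩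
  · have hxc : x < ⌊x⌋ + 1 := Int.lt_floor_add_one x
    have hcf : ⌈x⌉ = ⌊x⌋ + 1 := by
      rw [Int.ceil_eq_iff]
      push_cast
      exact ⟨by linarith, hxc.le⟩
    constructor
    · symm
      rw [Int.floor_eq_iff]
      exact ⟨hlow, by nlinarith⟩
    · symm
      rw [Int.ceil_eq_iff, hcf]
      push_cast
      exact ⟨by nlinarith, by nlinarith⟩

lemma exists_combination {K : ℕ} (hK : 0 < K) {x y : ℝ} (h : SameCell (K * x) (K * y)) :
    ∃ z t : ℝ, InCell (K * x) (K * z) ∧ 0 ≤ t ∧ t < 1 ∧ y = (1 - t) * x + t * z := by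
  have hK' : (0 : ℝ) < K := by exact_mod_cast hK
  have h2 : (⌊K * x⌋ : ℝ) = ⌊K * y⌋ := by exact_mod_cast h.1
  have h3 : (⌈K * x⌉ : ℝ) = ⌈K * y⌉ := by exact_mod_cast h.2
  have e : ∀ a : ℝ, K * (a / K) = a := fun a => by field_simp
  rcases lt_trichotomy y x with hxy | rfl | hxy
  · have hyx : K * y < K * x := by gcongr
    have hlt : (⌊K * x⌋ : ℝ) < K * y := by
      rw [h2]
      refine (Int.floor_le _).lt_of_ne fun he => ?_
      have : (⌈K * y⌉ : ℝ) = K * y := by rw [← he]; simp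
      linarith [Int.le_ceil (K * x)]
    have hz : (⌊K * x⌋ / K : ℝ) < y := by rw [div_lt_iff₀ hK']; linarith
    refine ⟨⌊K * x⌋ / K, (x - y) / (x - ⌊K * x⌋ / K), ?_, ?_, ?_, ?_⟩
    · rw [e]
      exact ⟨le_rfl, (Int.floor_le _).trans (Int.le_ceil _)⟩
    · exact div_nonneg (by linarith) (by linarith)
    · rw [div_lt_one (by linarith)]
      linarith
    · have : x - ⌊K * x⌋ / K ≠ 0 := by linarith
      generalize (⌊K * x⌋ / K : ℝ) = z at *
      field_simp
      ring
  · exact ⟨y, 0, inCell_self _, le_rfl, one_pos, by ring⟩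
  · have hyx : K * x < K * y := by gcongr
    have hlt : K * y < (⌈K * x⌉ : ℝ) := by
      rw [h3]
      refine (Int.le_ceil _).lt_of_ne fun he => ?_
      have : (⌊K * y⌋ : ℝ) = K * y := by rw [he]; simp
      linarith [Int.floor_le (K * x)]
    have hz : y < (⌈K * x⌉ / K : ℝ) := by rw [lt_div_iff₀ hK']; linarith
    refine ⟨⌈K * x⌉ / K, (y - x) / (⌈K * x⌉ / K - x), ?_, ?_, ?_, ?_⟩
    · rw [e]
      exact ⟨(Int.floor_le _).trans (Int.le_ceil _), le_rfl⟩
    · exact div_nonneg (by linarith) (by linarith)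
    · rw [div_lt_one (by linarith)]
      linarith
    · have : ⌈K * x⌉ / K - x ≠ 0 := by linarith
      generalize (⌈K * x⌉ / K : ℝ) = z at *
      field_simp
      ring

lemma entry_combination (R : ℕ → Bool) (x z t : ℝ) (m w : ℕ → ℝ) (n : ℕ) :
    entry R ((1 - t) * x + t * z) (fun i => (1 - t) * m i + t * w i) n =
      (1 - t) * entry R x m n + t * entry R z w n := by
  cases n with
  | zero => rfl
  | succ n =>
    simp only [entry]
    split_ifs <;> ring

lemma budget_combination (r d : ℕ → ℕ) (R : ℕ → Bool) (x z t u : ℝ) (m w : ℕ → ℝ) (n : ℕ) :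
    budget r d R ((1 - t) * x + t * z) u (fun i => (1 - t) * m i + t * w i) n =
      (1 - t) * budget r d R x u m n + t * budget r d R z u w n := by
  simp only [budget, entry_combination, mul_sub, Finset.mul_sum]
  have : ∀ a b : ℝ, (1 - t) * u - a + (t * u - b) = u - (a + b) := by intros; ring
  rw [this, ← Finset.sum_add_distrib]
  congr 1
  refine Finset.sum_congr rfl fun i _ => ?_
  ring

/-- A trajectory from `x` can be imitated from every `y` in the same `1/K`-cell, with the same
integer cells and the same signs of the remaining budget. -/
theorem exists_imitation {r d : ℕ → ℕ} {R : ℕ → Bool} {x y : ℝ} {m : ℕ → ℝ} {u K : ℕ} (hK : 0 < K)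
    (hm : ∀ i, entry R x m i ≤ m i) (hu : u = 0 ∨ ∀ i, r i = 0 ∨ r i ∣ K)
    (hxy : SameCell (K * x) (K * y)) :
    ∃ w : ℕ → ℝ, (∀ i, entry R y w i ≤ w i) ∧ (∀ i, SameCell (m i) (w i)) ∧
      ∀ n, (0 < budget r d R x u m n ↔ 0 < budget r d R y u w n) ∧
        (budget r d R x u m n < 0 ↔ budget r d R y u w n < 0) := by
  obtain ⟨z, t, hz, ht0, ht1, rfl⟩ := exists_combination hK hxy
  obtain ⟨w, hw⟩ := exists_follows (d := d) hK hm hu hz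
  refine ⟨fun i => (1 - t) * m i + t * w i, fun i => ?_, fun i => ?_, fun n => ?_⟩
  · rw [entry_combination]
    have h1 := hm i
    have h2 := (hw (i + 1)).2.1 i (by omega)
    nlinarith
  · exact sameCell_combination ht0 ht1 ((hw 0).1 i)
  · rw [budget_combination]
    obtain ⟨h1, h2⟩ := (hw n).2.2 n le_rfl
    generalize budget r d R x u m n = a at *
    generalize budget r d R z u w n = b at *
    rcases lt_trichotomy a 0 with h | rfl | h
    · have := h2 h.le
      have : (1 - t) * a + t * b < 0 := by nlinarith
      simp [h, this, h.le.not_gt, this.le.not_gt]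
    · have : b = 0 := le_antisymm (h2 le_rfl) (h1 le_rfl)
      simp [this]
    · have := h1 h.le
      have : 0 < (1 - t) * a + t * b := by nlinarith
      simp [h, this, h.le.not_gt, this.le.not_gt]

lemma sameCell_iff {x y : ℝ} :
    SameCell x y ↔ ∀ k : ℤ, ((k : ℝ) ≤ x ↔ (k : ℝ) ≤ y) ∧ (x ≤ k ↔ y ≤ k) := by
  constructor
  · rintro ⟨h1, h2⟩ k
    exact ⟨by rw [← Int.le_floor, h1, Int.le_floor], by rw [← Int.ceil_le, h2, Int.ceil_le]⟩
  · intro h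
    refine ⟨eq_of_forall_le_iff fun k => ?_, eq_of_forall_ge_iff fun k => ?_⟩
    · rw [Int.le_floor, Int.le_floor, (h k).1]
    · rw [Int.ceil_le, Int.ceil_le, (h k).2]

lemma SameCell.symm {x y : ℝ} (h : SameCell x y) : SameCell y x := ⟨h.1.symm, h.2.symm⟩

lemma SameCell.of_mul {t : ℕ} (ht : 0 < t) {x y : ℝ} (h : SameCell (t * x) (t * y)) :
    SameCell x y := by
  have ht' : (0 : ℝ) < t := by exact_mod_cast ht
  rw [sameCell_iff] at h ⊢
  intro k
  have := h (t * k)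
  push_cast at this
  simpa only [mul_le_mul_iff_right₀ ht'] using this

lemma sameCell_of_mem_Ioo {x y : ℝ} {k : ℤ} (hx : k < x) (hx' : x < k + 1) (hy : k < y)
    (hy' : y < k + 1) : SameCell x y := by
  have hf : ∀ z : ℝ, k < z → z < k + 1 → ⌊z⌋ = k ∧ ⌈z⌉ = k + 1 := fun z h1 h2 =>
    ⟨by rw [Int.floor_eq_iff]; exact ⟨h1.le, h2⟩,
      by rw [Int.ceil_eq_iff]; push_cast; exact ⟨by linarith, h2.le⟩⟩
  exact ⟨(hf x hx hx').1.trans (hf y hy hy').1.symm, (hf x hx hx').2.trans (hf y hy hy').2.symm⟩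

lemma entry_mul (R : ℕ → Bool) (N z : ℝ) (w : ℕ → ℝ) (n : ℕ) :
    entry R (N * z) (fun i => N * w i) n = N * entry R z w n := by
  cases n with
  | zero => rfl
  | succ n =>
    simp only [entry]
    split_ifs <;> simp

lemma entry_nonneg {R : ℕ → Bool} {z : ℝ} {w : ℕ → ℝ} (hz : 0 ≤ z) (hw : ∀ i, entry R z w i ≤ w i)
    (n : ℕ) : 0 ≤ entry R z w n := by
  induction n with
  | zero => exact hz
  | succ n ih =>
    simp only [entry]
    split_ifs
    · exact le_rfl
    · exact ih.trans (hw n)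

lemma SameCell.entry {R : ℕ → Bool} {x y : ℝ} {m w : ℕ → ℝ} (h : SameCell x y)
    (hw : ∀ i, SameCell (m i) (w i)) (n : ℕ) :
    SameCell (ClockTrace.entry R x m n) (ClockTrace.entry R y w n) := by
  cases n with
  | zero => exact h
  | succ n =>
    simp only [ClockTrace.entry]
    split_ifs
    · exact ⟨rfl, rfl⟩
    · exact hw n

end ClockTrace

/-! ## Runs of priced timed automata -/

open ClockTrace

lemma Cmp.sat_congr {x y a b : ℝ} (h1 : x < a ↔ y < b) (h2 : a < x ↔ b < y) (cmp : Cmp) :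
    Cmp.sat cmp x a ↔ Cmp.sat cmp y b := by
  have h3 : x ≤ a ↔ y ≤ b := by rw [← not_lt, h2, not_lt]
  have h4 : a ≤ x ↔ b ≤ y := by rw [← not_lt, h1, not_lt]
  cases cmp
  · exact h1
  · exact h3
  · simp only [Cmp.sat, le_antisymm_iff, h3, h4]
  · exact h4
  · exact h2

lemma PGuard.sat_of_sameCell {g : PGuard} {N : ℕ} (hN : 0 < N) {x y : ℝ}
    (h : SameCell (N * x) (N * y)) (hx : g.sat x) : g.sat y := by
  intro p hp
  refine (Cmp.sat_congr ?_ ?_ p.1).1 (hx p hp)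
  all_goals
    have := (sameCell_iff.1 (h.of_mul hN)) p.2
    push_cast at this
    rw [← not_le, ← not_le]
  · rw [this.1]
  · rw [this.2]

lemma PGuard.sat_of_gt {g : PGuard} {M : ℕ} (hM : ∀ p ∈ g, p.2 ≤ M) {x y : ℝ} (hxM : M < x)
    (hyM : M < y) (hx : g.sat x) : g.sat y := by
  intro p hp
  have hpM : (p.2 : ℝ) ≤ M := by exact_mod_cast hM p hp
  refine (Cmp.sat_congr ?_ ?_ p.1).1 (hx p hp)
  · exact iff_of_false (by linarith) (by linarith)
  · exact iff_of_true (by linarith) (by linarith)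

lemma NonBlocking.sat_inv {A : PTA Q} (h : NonBlocking A) (q : Q) {v : ℝ} (hv : 0 ≤ v) :
    PGuard.sat (A.Inv q) v := by
  obtain ⟨_, _, _, _, _, ⟨t, ht, _, _, hI⟩, _⟩ := h q v hv
  simpa using hI 0 le_rfl ht

/-- `m` and `e` are the clock values at, and the transitions of, the discrete moves of `ρ`. -/
structure InfRun.IsTrace {A : PTA Q} {s : Q × ℝ} (ρ : InfRun A s) (m : ℕ → ℝ)
    (e : ℕ → PTrans Q) : Prop where
  clock : ∀ n, (ρ.st n).2 = entry (fun i => (e i).reset) s.2 m n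
  entry_le : ∀ n, entry (fun i => (e i).reset) s.2 m n ≤ m n
  mem : ∀ n, e n ∈ A.E
  src : ∀ n, (e n).src = (ρ.st n).1
  tgt : ∀ n, (e n).tgt = (ρ.st (n + 1)).1
  guard : ∀ n, PGuard.sat (e n).guard (m n)
  cost : ∀ n, ρ.cst n =
    (m n - entry (fun i => (e i).reset) s.2 m n) * A.rate (ρ.st n).1 + (e n).dcost

lemma InfRun.exists_isTrace {A : PTA Q} {s : Q × ℝ} (ρ : InfRun A s) :
    ∃ m e, ρ.IsTrace m e := by
  have h : ∀ n, ∃ (m : ℝ) (e : PTrans Q), e ∈ A.E ∧ e.src = (ρ.st n).1 ∧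
      e.tgt = (ρ.st (n + 1)).1 ∧ PGuard.sat e.guard m ∧ (ρ.st n).2 ≤ m ∧
      (ρ.st (n + 1)).2 = (if e.reset then 0 else m) ∧
      ρ.cst n = (m - (ρ.st n).2) * A.rate (ρ.st n).1 + e.dcost := by
    intro n
    obtain ⟨c₁, c₂, _, ⟨t, ht, rfl, hc₁, _⟩, ⟨e, he, hs, hg, hsat, hr, _, hc₂⟩, hc⟩ := ρ.step n
    refine ⟨_, e, he, hs, hg, hsat, ?_, hr, ?_⟩
    · simpa using ht
    · rw [hc, hc₁, hc₂, add_sub_cancel_left]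
  choose m e h1 h2 h3 h4 h5 h6 h7 using h
  have hclock : ∀ n, (ρ.st n).2 = entry (fun i => (e i).reset) s.2 m n := by
    rintro (_ | n)
    · rw [ρ.first]; rfl
    · exact h6 n
  exact ⟨m, e, hclock, fun n => hclock n ▸ h5 n, h1, h2, h3, h4, fun n => hclock n ▸ h7 n⟩

lemma InfRun.IsTrace.exists_run {A : PTA Q} (hA : NonBlocking A) {q : Q} {x y : ℝ}
    {ρ : InfRun A (q, x)} {m w : ℕ → ℝ} {e : ℕ → PTrans Q} (h : ρ.IsTrace m e) (hy : 0 ≤ y)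
    (hw : ∀ n, entry (fun i => (e i).reset) y w n ≤ w n)
    (hg : ∀ n, PGuard.sat (e n).guard (w n)) :
    ∃ ρ' : InfRun A (q, y),
      (∀ n, ρ'.st n = ((ρ.st n).1, entry (fun i => (e i).reset) y w n)) ∧
      ∀ n, ρ'.cst n =
        (w n - entry (fun i => (e i).reset) y w n) * A.rate (ρ.st n).1 + (e n).dcost := by
  have h0 := entry_nonneg hy hw
  refine ⟨⟨fun n => ((ρ.st n).1, entry (fun i => (e i).reset) y w n), _, ?_, fun n => ?_⟩,
    fun n => rfl, fun n => rfl⟩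
  · simp only [ρ.first]
    rfl
  · refine ⟨_, _, ((ρ.st n).1, w n),
      ⟨w n - entry (fun i => (e i).reset) y w n, sub_nonneg.2 (hw n), by simp, rfl,
        fun t ht _ => hA.sat_inv _ (add_nonneg (h0 n) ht)⟩,
      ⟨e n, h.mem n, h.src n, h.tgt n, hg n, rfl, hA.sat_inv _ (h0 (n + 1)), rfl⟩, rfl⟩

lemma InfRun.IsTrace.budget_eq {A : PTA Q} {q : Q} {x : ℝ} {ρ : InfRun A (q, x)} {y : ℝ}
    {w cst : ℕ → ℝ} {e : ℕ → PTrans Q} (N c n : ℕ)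
    (hcst : ∀ n, cst n =
      (w n - entry (fun i => (e i).reset) y w n) * A.rate (ρ.st n).1 + (e n).dcost) :
    budget (fun i => A.rate (ρ.st i).1) (fun i => N * (e i).dcost) (fun i => (e i).reset) (N * y)
      ((N * c : ℕ) : ℝ) (fun i => N * w i) n = N * (c - ∑ i ∈ Finset.range n, cst i) := by
  simp only [budget, entry_mul, hcst, mul_sub, Finset.mul_sum]
  push_cast
  congr 1
  refine Finset.sum_congr rfl fun i _ => ?_
  ring

/-- Runs from states of one `1/(N K)`-cell can be imitated while keeping `1/N`-cells and the
comparison of all accumulated costs with `c`. -/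
lemma InfRun.exists_imitation {A : PTA Q} (hA : NonBlocking A) {N K c : ℕ} (hN : 0 < N)
    (hK : 0 < K) (hc : c = 0 ∨ ∀ q, A.rate q = 0 ∨ A.rate q ∣ K) {q : Q} {x y : ℝ} (hx : 0 ≤ x)
    (hy : 0 ≤ y) (hxy : SameCell (K * (N * x)) (K * (N * y))) (ρ : InfRun A (q, x)) :
    ∃ ρ' : InfRun A (q, y), ∀ n, (ρ'.st n).1 = (ρ.st n).1 ∧ 0 ≤ (ρ.st n).2 ∧
      SameCell (N * (ρ.st n).2) (N * (ρ'.st n).2) ∧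
      ∀ cmp, Cmp.sat cmp (∑ i ∈ Finset.range n, ρ.cst i) (c : ℝ) ↔
        Cmp.sat cmp (∑ i ∈ Finset.range n, ρ'.cst i) (c : ℝ) := by
  have hN' : (0 : ℝ) < N := by exact_mod_cast hN
  obtain ⟨m, e, h⟩ := ρ.exists_isTrace
  obtain ⟨W, hW1, hW2, hW3⟩ := ClockTrace.exists_imitation (r := fun i => A.rate (ρ.st i).1)
    (d := fun i => N * (e i).dcost) (R := fun i => (e i).reset) (m := fun i => N * m i)
    (u := N * c) hK
    (fun i => by rw [entry_mul]; exact mul_le_mul_of_nonneg_left (h.entry_le i) hN'.le)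
    (hc.imp (fun h => by simp [h]) fun h i => h _) hxy
  obtain ⟨w, rfl⟩ : ∃ w : ℕ → ℝ, W = fun i => N * w i :=
    ⟨fun i => W i / N, by funext i; field_simp⟩
  obtain ⟨ρ', hst, hcst⟩ := h.exists_run hA hy
    (fun n => le_of_mul_le_mul_left (by simpa only [entry_mul] using hW1 n) hN')
    (fun n => PGuard.sat_of_sameCell hN (hW2 n) (h.guard n))
  refine ⟨ρ', fun n => ⟨by rw [hst], ?_, ?_, fun cmp => ?_⟩⟩
  · rw [h.clock]
    exact entry_nonneg hx h.entry_le n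
  · rw [h.clock, hst, ← entry_mul, ← entry_mul]
    exact (hxy.of_mul hK).entry hW2 n
  · have := hW3 n
    rw [InfRun.IsTrace.budget_eq N c n h.cost, InfRun.IsTrace.budget_eq N c n hcst] at this
    simp only [mul_pos_iff_of_pos_left hN', mul_neg_iff, hN', hN'.not_gt, true_and, false_and,
      or_false, sub_pos, sub_neg] at this
    exact Cmp.sat_congr this.1 this.2 cmp

/-- Beyond all constants, runs can be translated. -/
lemma InfRun.exists_translation {A : PTA Q} (hA : NonBlocking A) {M : ℕ}
    (hM : ∀ c ∈ PTA.consts A, c ≤ M) {q : Q} {x y : ℝ} (hx : M < x) (hy : M < y)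
    (ρ : InfRun A (q, x)) :
    ∃ ρ' : InfRun A (q, y), ∀ n, (ρ'.st n).1 = (ρ.st n).1 ∧
      ((ρ.st n).2 = (ρ'.st n).2 ∨ (M < (ρ.st n).2 ∧ M < (ρ'.st n).2)) ∧
      ρ.cst n = ρ'.cst n := by
  classical
  obtain ⟨m, e, h⟩ := ρ.exists_isTrace
  set R : ℕ → Bool := fun i => (e i).reset with hR
  set w : ℕ → ℝ := fun n => if ∀ j < n, R j = false then m n + (y - x) else m n with hw
  have hent : ∀ n, entry R y w n =
      if ∀ j < n, R j = false then entry R x m n + (y - x) else entry R x m n := by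
    rintro (_ | n)
    · simp [entry]
    · simp only [entry, Nat.forall_lt_succ_right, hw]
      by_cases hr : R n = false <;> simp [hr]
  have hgt : ∀ n, (∀ j < n, R j = false) → x ≤ entry R x m n := by
    intro n
    induction n with
    | zero => exact fun _ => le_rfl
    | succ n ih =>
      intro hj
      have := (ih fun j hj' => hj j (by omega)).trans (h.entry_le n)
      simpa [entry, hj n (by omega)] using this
  have hdelay : ∀ n, w n - entry R y w n = m n - entry R x m n := by
    intro n
    rw [hent]
    simp only [hw]
    split_ifs <;> ring
  have hle : ∀ n, entry R y w n ≤ w n := fun n => by linarith [hdelay n, h.entry_le n]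
  obtain ⟨ρ', hst, hcst⟩ := h.exists_run hA ((Nat.cast_nonneg M).trans hy.le) hle fun n => by
    by_cases hj : ∀ j < n, R j = false
    · have h1 := hgt n hj
      have h2 : w n = m n + (y - x) := if_pos hj
      have h3 := h.entry_le n
      refine PGuard.sat_of_gt (M := M) (fun p hp => hM _ (Or.inl ⟨_, h.mem n, p, hp, rfl⟩))
        ?_ ?_ (h.guard n)
      · exact hx.trans_le (h1.trans h3)
      · rw [h2]
        have : x ≤ m n := h1.trans h3
        linarith
    · have h2 : w n = m n := if_neg hj
      rw [h2]
      exact h.guard n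
  refine ⟨ρ', fun n => ⟨by rw [hst], ?_, ?_⟩⟩
  · rw [h.clock, hst]
    change entry R x m n = entry R y w n ∨ M < entry R x m n ∧ M < entry R y w n
    rw [hent]
    split_ifs with hj
    · have := hgt n hj
      exact Or.inr ⟨by linarith, by linarith⟩
    · exact Or.inl rfl
  · rw [hcst, h.cost]
    congr 2
    exact (hdelay n).symm

/-! ## Uniformity of WCTL formulas -/

section

variable {AP : Type}

/-- The condition on a run in the semantics of the modality `φ U_{∼c} ψ`. -/
def UntilHolds {A : PTA Q} (L : Q → AP → Prop) (φ : WCTL AP) (cmp : Cmp) (c : ℕ) (ψ : WCTL AP)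
    {s : Q × ℝ} (ρ : InfRun A s) : Prop :=
  ∃ π : ℕ, 0 < π ∧ WCTLsat A L ψ (ρ.st π) ∧
    (∀ π' : ℕ, 0 < π' → π' < π → WCTLsat A L φ (ρ.st π')) ∧
    Cmp.sat cmp (∑ i ∈ Finset.range π, ρ.cst i) (c : ℝ)

lemma until_congr {A : PTA Q} {L : Q → AP → Prop} {φ ψ : WCTL AP} {cmp : Cmp} {c : ℕ}
    {s s' : Q × ℝ} {ρ : InfRun A s} {ρ' : InfRun A s'}
    (h : ∀ n, (WCTLsat A L φ (ρ.st n) ↔ WCTLsat A L φ (ρ'.st n)) ∧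
      (WCTLsat A L ψ (ρ.st n) ↔ WCTLsat A L ψ (ρ'.st n)) ∧
      (Cmp.sat cmp (∑ i ∈ Finset.range n, ρ.cst i) (c : ℝ) ↔
        Cmp.sat cmp (∑ i ∈ Finset.range n, ρ'.cst i) (c : ℝ))) :
    UntilHolds L φ cmp c ψ ρ ↔ UntilHolds L φ cmp c ψ ρ' := by
  simp only [UntilHolds, h]

lemma wctlSat_EU_iff {A : PTA Q} {L : Q → AP → Prop} {φ ψ : WCTL AP} {cmp : Cmp} {c : ℕ}
    {s s' : Q × ℝ}
    (h : ∀ ρ : InfRun A s, ∃ ρ' : InfRun A s',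
      UntilHolds L φ cmp c ψ ρ ↔ UntilHolds L φ cmp c ψ ρ')
    (h' : ∀ ρ : InfRun A s', ∃ ρ' : InfRun A s,
      UntilHolds L φ cmp c ψ ρ ↔ UntilHolds L φ cmp c ψ ρ') :
    WCTLsat A L (.EU φ cmp c ψ) s ↔ WCTLsat A L (.EU φ cmp c ψ) s' :=
  ⟨fun ⟨ρ, hρ⟩ => (h ρ).imp fun _ e => e.1 hρ, fun ⟨ρ, hρ⟩ => (h' ρ).imp fun _ e => e.1 hρ⟩

lemma wctlSat_AU_iff {A : PTA Q} {L : Q → AP → Prop} {φ ψ : WCTL AP} {cmp : Cmp} {c : ℕ}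
    {s s' : Q × ℝ}
    (h : ∀ ρ : InfRun A s, ∃ ρ' : InfRun A s',
      UntilHolds L φ cmp c ψ ρ ↔ UntilHolds L φ cmp c ψ ρ')
    (h' : ∀ ρ : InfRun A s', ∃ ρ' : InfRun A s,
      UntilHolds L φ cmp c ψ ρ ↔ UntilHolds L φ cmp c ψ ρ') :
    WCTLsat A L (.AU φ cmp c ψ) s ↔ WCTLsat A L (.AU φ cmp c ψ) s' :=
  ⟨fun H ρ => let ⟨ρ', e⟩ := h' ρ; e.2 (H ρ'), fun H ρ => let ⟨ρ', e⟩ := h ρ; e.2 (H ρ')⟩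

lemma posLcm_pos (A : PTA Q) : 0 < posLcm A := by
  refine Nat.pos_of_ne_zero fun h => ?_
  obtain ⟨q, hq, h0⟩ := Finset.lcm_eq_zero_iff.1 h
  simp at hq
  omega

lemma rate_dvd_posLcm (A : PTA Q) (q : Q) : A.rate q = 0 ∨ A.rate q ∣ posLcm A := by
  rcases Nat.eq_zero_or_pos (A.rate q) with h | h
  · exact Or.inl h
  · exact Or.inr (Finset.dvd_lcm (by simpa using h))

/-- The truth value of `Φ` is uniform on the `1/N`-cells. -/
def UniformOnCells (A : PTA Q) (L : Q → AP → Prop) (Φ : WCTL AP) (N : ℕ) : Prop :=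
  ∀ (q : Q) (x y : ℝ), 0 ≤ x → SameCell (N * x) (N * y) →
    (WCTLsat A L Φ (q, x) ↔ WCTLsat A L Φ (q, y))

lemma UniformOnCells.pow_mono {A : PTA Q} {L : Q → AP → Prop} {Φ : WCTL AP} {C i j : ℕ}
    (hC : 0 < C) (hij : i ≤ j) (h : UniformOnCells A L Φ (C ^ i)) :
    UniformOnCells A L Φ (C ^ j) := by
  intro q x y hx hxy
  obtain ⟨k, rfl⟩ := Nat.exists_eq_add_of_le' hij
  refine h q x y hx (SameCell.of_mul (pow_pos hC k) ?_)
  simpa only [pow_add, Nat.cast_mul, mul_assoc] using hxy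

lemma nonneg_of_sameCell {N : ℕ} (hN : 0 < N) {x y : ℝ} (h : SameCell (N * x) (N * y))
    (hx : 0 ≤ x) : 0 ≤ y := by
  simpa using (((sameCell_iff.1 (h.of_mul hN)) 0).1.1 (by simpa using hx))

lemma exists_run_until_iff {A : PTA Q} (hA : NonBlocking A) {L : Q → AP → Prop} {φ ψ : WCTL AP}
    {cmp : Cmp} {c N : ℕ} (hN : 0 < N) (hφ : UniformOnCells A L φ N) (hψ : UniformOnCells A L ψ N)
    {q : Q} {x y : ℝ} (hx : 0 ≤ x)
    (hxy : SameCell ((N * posLcm A ^ (if isTrivialC cmp c then 0 else 1) : ℕ) * x)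
      ((N * posLcm A ^ (if isTrivialC cmp c then 0 else 1) : ℕ) * y)) (ρ : InfRun A (q, x)) :
    ∃ ρ' : InfRun A (q, y), UntilHolds L φ cmp c ψ ρ ↔ UntilHolds L φ cmp c ψ ρ' := by
  have hC := posLcm_pos A
  have hc : c = 0 ∨ ∀ q, A.rate q = 0 ∨
      A.rate q ∣ posLcm A ^ (if isTrivialC cmp c then 0 else 1) := by
    split_ifs with ht
    · left
      cases cmp <;> cases c <;> simp [isTrivialC] at ht ⊢
    · right
      simpa using rate_dvd_posLcm A
  obtain ⟨ρ', h⟩ := ρ.exists_imitation hA hN (pow_pos hC _) hc hx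
    (nonneg_of_sameCell (Nat.mul_pos hN (pow_pos hC _)) hxy hx)
    (by rw [mul_comm N] at hxy; simpa only [Nat.cast_mul, mul_assoc] using hxy)
  refine ⟨ρ', until_congr fun n => ?_⟩
  obtain ⟨h1, h2, h3, h4⟩ := h n
  have e : ρ'.st n = ((ρ.st n).1, (ρ'.st n).2) := Prod.ext h1 rfl
  rw [e]
  exact ⟨hφ _ _ _ h2 h3, hψ _ _ _ h2 h3, h4 cmp⟩

theorem uniformOnCells {A : PTA Q} (hA : NonBlocking A) (L : Q → AP → Prop) (Φ : WCTL AP) :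
    UniformOnCells A L Φ (posLcm A ^ cheight Φ) := by
  have hC := posLcm_pos A
  induction Φ with
  | tt => exact fun _ _ _ _ _ => Iff.rfl
  | atom a => exact fun _ _ _ _ _ => Iff.rfl
  | not φ ih => exact fun q x y hx hxy => not_congr (ih q x y hx hxy)
  | or φ ψ ih1 ih2 =>
    exact fun q x y hx hxy => or_congr ((ih1.pow_mono hC (le_max_left _ _)) q x y hx hxy)
      ((ih2.pow_mono hC (le_max_right _ _)) q x y hx hxy)
  | EU φ cmp c ψ ih1 ih2 =>
    intro q x y hx hxy
    have hy := nonneg_of_sameCell (pow_pos hC _) hxy hx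
    rw [cheight, pow_add] at hxy
    have hrun := fun {x y : ℝ} => exists_run_until_iff hA (pow_pos hC _)
      (ih1.pow_mono hC (le_max_left _ _)) (ih2.pow_mono hC (le_max_right _ _)) (cmp := cmp) (c := c)
      (q := q) (x := x) (y := y)
    exact wctlSat_EU_iff (hrun hx hxy) (hrun hy hxy.symm)
  | AU φ cmp c ψ ih1 ih2 =>
    intro q x y hx hxy
    have hy := nonneg_of_sameCell (pow_pos hC _) hxy hx
    rw [cheight, pow_add] at hxy
    have hrun := fun {x y : ℝ} => exists_run_until_iff hA (pow_pos hC _)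
      (ih1.pow_mono hC (le_max_left _ _)) (ih2.pow_mono hC (le_max_right _ _)) (cmp := cmp) (c := c)
      (q := q) (x := x) (y := y)
    exact wctlSat_AU_iff (hrun hx hxy) (hrun hy hxy.symm)

lemma exists_run_until_iff_of_gt {A : PTA Q} (hA : NonBlocking A) {M : ℕ}
    (hM : ∀ c ∈ PTA.consts A, c ≤ M) {L : Q → AP → Prop} {φ ψ : WCTL AP} {cmp : Cmp} {c : ℕ}
    (hφ : ∀ (q : Q) (x y : ℝ), M < x → M < y → (WCTLsat A L φ (q, x) ↔ WCTLsat A L φ (q, y)))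
    (hψ : ∀ (q : Q) (x y : ℝ), M < x → M < y → (WCTLsat A L ψ (q, x) ↔ WCTLsat A L ψ (q, y)))
    {q : Q} {x y : ℝ} (hx : M < x) (hy : M < y) (ρ : InfRun A (q, x)) :
    ∃ ρ' : InfRun A (q, y), UntilHolds L φ cmp c ψ ρ ↔ UntilHolds L φ cmp c ψ ρ' := by
  obtain ⟨ρ', h⟩ := ρ.exists_translation hA hM hx hy
  refine ⟨ρ', until_congr fun n => ?_⟩
  obtain ⟨h1, h2, -⟩ := h n
  have e : ρ'.st n = ((ρ.st n).1, (ρ'.st n).2) := Prod.ext h1 rfl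
  simp only [fun i => (h i).2.2]
  rw [e]
  rcases h2 with h2 | h2
  · rw [← h2]
    exact ⟨Iff.rfl, Iff.rfl, trivial⟩
  · exact ⟨hφ _ _ _ h2.1 h2.2, hψ _ _ _ h2.1 h2.2, trivial⟩

theorem wctlSat_iff_of_gt {A : PTA Q} (hA : NonBlocking A) {M : ℕ}
    (hM : ∀ c ∈ PTA.consts A, c ≤ M) (L : Q → AP → Prop) (Φ : WCTL AP) :
    ∀ (q : Q) (x y : ℝ), M < x → M < y → (WCTLsat A L Φ (q, x) ↔ WCTLsat A L Φ (q, y)) := by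
  induction Φ with
  | tt => exact fun _ _ _ _ _ => Iff.rfl
  | atom a => exact fun _ _ _ _ _ => Iff.rfl
  | not φ ih => exact fun q x y hx hy => not_congr (ih q x y hx hy)
  | or φ ψ ih1 ih2 => exact fun q x y hx hy => or_congr (ih1 q x y hx hy) (ih2 q x y hx hy)
  | EU φ cmp c ψ ih1 ih2 =>
    exact fun q x y hx hy => wctlSat_EU_iff (exists_run_until_iff_of_gt hA hM ih1 ih2 hx hy)
      (exists_run_until_iff_of_gt hA hM ih1 ih2 hy hx)
  | AU φ cmp c ψ ih1 ih2 =>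
    exact fun q x y hx hy => wctlSat_AU_iff (exists_run_until_iff_of_gt hA hM ih1 ih2 hx hy)
      (exists_run_until_iff_of_gt hA hM ih1 ih2 hy hx)

end

/-- **Proposition 2.** Let `Φ` be a WCTL formula and `A` a one-clock priced
timed automaton (non-blocking), and let `M` be the largest constant appearing in the clock
constraints of `A` (`M = 0` if there is none). Then there are constants
`0 = a 0 < a 1 < … < a n` (with `a (n+1) = +∞`) such that:
(i) the truth value of `Φ` is uniform on every `{(q,x) | a i < x < a (i+1)}`
(where the upper constraint disappears for `i = n`);
(ii) every constant of the clock constraints of `A` is some `a i`;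
(iii) every `a i` is an integral multiple of `1 / C ^ h(Φ)` where `C` is the lcm of the
positive cost rates of `A` and `h(Φ)` the constrained temporal height of `Φ`;
(iv) `a n = M`; and `n ≤ M · C ^ h(Φ) + 1`. -/
theorem stmt0 {Q AP : Type} [Fintype Q] (A : PTA Q) (L : Q → AP → Prop)
    (hnb : NonBlocking A)
    (M : ℕ) (hub : ∀ c ∈ PTA.consts A, c ≤ M) (hmem : M = 0 ∨ M ∈ PTA.consts A)
    (Φ : WCTL AP) :
    ∃ (n : ℕ) (a : ℕ → ℝ),
      a 0 = 0 ∧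
      (∀ i j : ℕ, i ≤ n → j ≤ n → i < j → a i < a j) ∧
      (∀ (q : Q) (i : ℕ), i ≤ n → ∀ x y : ℝ,
        a i < x → (i < n → x < a (i + 1)) →
        a i < y → (i < n → y < a (i + 1)) →
        (WCTLsat A L Φ (q, x) ↔ WCTLsat A L Φ (q, y))) ∧
      (∀ c ∈ PTA.consts A, ∃ i ≤ n, a i = (c : ℝ)) ∧
      (∀ i ≤ n, ∃ k : ℕ, a i = (k : ℝ) / ((posLcm A ^ cheight Φ : ℕ) : ℝ)) ∧
      a n = (M : ℝ) ∧
      n ≤ M * posLcm A ^ cheight Φ + 1 := by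
  have hN : 0 < posLcm A ^ cheight Φ := pow_pos (posLcm_pos A) _
  have huni := uniformOnCells hnb L Φ
  generalize posLcm A ^ cheight Φ = N at hN huni
  have hN' : (0 : ℝ) < N := by exact_mod_cast hN
  have hlast : ((M * N : ℕ) : ℝ) / N = M := by
    push_cast
    field_simp
  refine ⟨M * N, fun i => (i : ℝ) / N, by simp, ?_, ?_, ?_, fun i _ => ⟨i, rfl⟩, hlast, by omega⟩
  · intro i j _ _ hij
    have : (i : ℝ) < j := by exact_mod_cast hij
    exact div_lt_div_of_pos_right this hN'
  · intro q i hi x y hx hx' hy hy'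
    rcases hi.eq_or_lt with rfl | hi
    · simp only [hlast] at hx hy
      exact wctlSat_iff_of_gt hnb hub L Φ q x y hx hy
    · have hx' := hx' hi
      have hy' := hy' hi
      have h0 : (0 : ℝ) ≤ (i : ℝ) / N := by positivity
      rw [div_lt_iff₀' hN'] at hx hy
      rw [lt_div_iff₀' hN'] at hx' hy'
      push_cast at hx' hy'
      refine huni q x y ?_ (sameCell_of_mem_Ioo (k := i) ?_ ?_ ?_ ?_)
      · have : 0 < (N : ℝ) * x := (Nat.cast_nonneg i).trans_lt hx
        exact (pos_of_mul_pos_right this hN'.le).le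
      all_goals simpa using ‹_›
  · intro c hc
    refine ⟨c * N, Nat.mul_le_mul_right N (hub c hc), ?_⟩
    push_cast
    field_simp
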